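/- Let p and q be prime numbers with p ≡ 5 (mod 8), q ≡ 3 (mod 8), and Legendre symbol (p/q) = 1. Let K = ℚ(√2, √(pq)), and let ε₂, ε_{pq}, ε_{2pq} denote the images in the ring of integers of K of the fundamental units (greater than 1 under a real embedding with √2, √(pq) > 0) of ℚ(√2), ℚ(√(pq)), ℚ(√(2pq)) respectively. Then the product ε_{pq}·ε_{2pq} is a square in the ring of integers of K, and for any unit u with u² = ε_{pq}·ε_{2pq}, the unit group of the ring of integers of K is generated by −1, ε₂, ε_{pq} and u; that is, {ε₂, ε_{pq}, √(ε_{pq}ε_{2pq})} is a fundamental system of units of K. -/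

import Mathlib

/-- The real quadratic field `ℚ(√d)` as a subfield of `ℝ`. -/
noncomputable def QF (d : ℕ) : IntermediateField ℚ ℝ :=
  IntermediateField.adjoin ℚ {Real.sqrt d}

/-- The real value (under the inclusion in `ℝ`, where all square roots are
positive) of a unit of the ring of integers of a subfield `K` of `ℝ`. -/
noncomputable def uval {K : IntermediateField ℚ ℝ}
    (u : (integralClosure ℤ K)ˣ) : ℝ :=
  (((u : integralClosure ℤ K) : K) : ℝ)

/-- `t` is (the real value of) the fundamental unit of `ℚ(√d)`: a unit of the
ring of integers which is `> 1` and which generates the full unit group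
together with `-1`. -/
def IsFundUnit (d : ℕ) (t : ℝ) : Prop :=
  ∃ ε : (integralClosure ℤ (QF d))ˣ,
    uval ε = t ∧ 1 < t ∧
    ∀ u : (integralClosure ℤ (QF d))ˣ, ∃ n : ℤ, u = ε ^ n ∨ u = -(ε ^ n)

/-- The real multiquadratic field `ℚ(√a, √b)` as a subfield of `ℝ`. -/
noncomputable def K2 (a b : ℕ) : IntermediateField ℚ ℝ :=
  IntermediateField.adjoin ℚ {Real.sqrt a, Real.sqrt b}

theorem exists_mul_of_prime_of_isCoprime {r A B N : ℤ} (hr : Prime r) (hAB : IsCoprime A B)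
    (h : A * B = r * N) :
    (∃ A', A = r * A' ∧ IsCoprime A' B ∧ A' * B = N) ∨
      (∃ B', B = r * B' ∧ IsCoprime A B' ∧ A * B' = N) := by
  rcases hr.dvd_or_dvd (Dvd.intro _ h.symm) with ⟨C, rfl⟩ | ⟨C, rfl⟩
  · exact .inl ⟨C, rfl, hAB.of_mul_left_right, mul_left_cancel₀ hr.ne_zero (by linarith)⟩
  · exact .inr ⟨C, rfl, hAB.of_mul_right_right, mul_left_cancel₀ hr.ne_zero (by linarith)⟩

theorem exists_sq_of_isCoprime_of_pos {A B y : ℤ} (hAB : IsCoprime A B) (hA : 0 < A) (hB : 0 < B)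
    (h : A * B = y ^ 2) : ∃ a b : ℤ, A = a ^ 2 ∧ B = b ^ 2 ∧ y = a * b := by
  obtain ⟨a, ha⟩ := Int.sq_of_isCoprime hAB h
  obtain ⟨b, hb⟩ := Int.sq_of_isCoprime hAB.symm (by rw [mul_comm, h])
  replace ha : A = a ^ 2 := by rcases ha with ha | ha <;> nlinarith [sq_nonneg a]
  replace hb : B = b ^ 2 := by rcases hb with hb | hb <;> nlinarith [sq_nonneg b]
  have hy : y ^ 2 = (a * b) ^ 2 := by rw [← h, ha, hb]; ring
  rcases sq_eq_sq_iff_eq_or_eq_neg.1 hy with hy | hy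
  · exact ⟨a, b, ha, hb, hy⟩
  · exact ⟨a, -b, ha, by rw [hb]; ring, by rw [hy]; ring⟩

theorem legendreSym_eq_one_of_dvd {r : ℕ} [Fact r.Prime] {n : ℤ} (hn : legendreSym r n ≠ 0)
    (z : ℤ) (h : (r : ℤ) ∣ z ^ 2 - n) : legendreSym r n = 1 := by
  have hn' : ((n : ℤ) : ZMod r) ≠ 0 := fun h0 => hn ((legendreSym.eq_zero_iff r n).2 h0)
  refine (legendreSym.eq_one_iff r hn').2 ⟨(z : ZMod r), ?_⟩
  have := (ZMod.intCast_zmod_eq_zero_iff_dvd _ r).2 h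
  push_cast at this
  linear_combination -this

theorem not_dvd_sq_sub {r : ℕ} [Fact r.Prime] {n : ℤ} (hn : legendreSym r n = -1)
    (z : ℤ) : ¬ (r : ℤ) ∣ z ^ 2 - n := fun h => by
  have := legendreSym_eq_one_of_dvd (by rw [hn]; decide) z h
  rw [hn] at this
  exact absurd this (by decide)

theorem legendreSym_two_of_mod_eight {r : ℕ} [Fact r.Prime] (hr : r % 8 = 3 ∨ r % 8 = 5) :
    legendreSym r 2 = -1 := by
  rw [legendreSym.at_two (by omega), ZMod.χ₈_nat_eq_if_mod_eight,
    if_neg (by omega), if_neg (by omega)]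

/-- The values of the Legendre symbols at `-1`, `2`, `p`, `q` that drive the descent. -/
theorem legendreSym_values {p q : ℕ} [Fact p.Prime] [Fact q.Prime]
    (hp : p % 8 = 5) (hq : q % 8 = 3) (hleg : legendreSym q (p : ℤ) = 1) :
    (legendreSym q (-1) = -1 ∧ legendreSym q 2 = -1) ∧
      legendreSym p (-1) = 1 ∧ legendreSym p 2 = -1 ∧ legendreSym p (q : ℤ) = 1 := by
  refine ⟨⟨?_, legendreSym_two_of_mod_eight (.inl hq)⟩, ?_,
    legendreSym_two_of_mod_eight (.inr hp), ?_⟩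
  · rw [legendreSym.at_neg_one (by omega), ZMod.χ₄_nat_three_mod_four (by omega)]
  · rw [legendreSym.at_neg_one (by omega), ZMod.χ₄_nat_one_mod_four (by omega)]
  · rw [← legendreSym.quadratic_reciprocity_one_mod_four (by omega) (by omega), hleg]

theorem sq_sub_mul_sq_ne_neg_one {q : ℕ} [Fact q.Prime] (hq : q % 8 = 3) {n x y : ℤ}
    (hn : (q : ℤ) ∣ n) : x ^ 2 - n * y ^ 2 ≠ -1 := fun h => by
  obtain ⟨k, rfl⟩ := hn
  refine not_dvd_sq_sub (r := q) (n := -1) ?_ x ⟨k * y ^ 2, by linear_combination h⟩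
  rw [legendreSym.at_neg_one (by omega), ZMod.χ₄_nat_three_mod_four (by omega)]

theorem isCoprime_add_one (A : ℤ) : IsCoprime (A + 1) A := ⟨1, -1, by ring⟩

theorem exists_sq_of_mul_eq_mul_sq {r s A B y : ℤ} (hr : Prime r) (hs : Prime s) (hr0 : 0 < r)
    (hs0 : 0 < s) (hAB : IsCoprime A B) (hA : 0 < A) (hB : 0 < B) (h : A * B = r * (s * y ^ 2)) :
    ∃ a b : ℤ, y = a * b ∧ ((A = a ^ 2 ∧ B = r * s * b ^ 2) ∨ (A = r * a ^ 2 ∧ B = s * b ^ 2) ∨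
      (A = s * a ^ 2 ∧ B = r * b ^ 2) ∨ (A = r * s * a ^ 2 ∧ B = b ^ 2)) := by
  rcases exists_mul_of_prime_of_isCoprime hr hAB h with ⟨C, rfl, hc, h1⟩ | ⟨C, rfl, hc, h1⟩ <;>
  rcases exists_mul_of_prime_of_isCoprime hs hc h1 with ⟨D, rfl, hc, h2⟩ | ⟨D, rfl, hc, h2⟩ <;>
  simp only [mul_pos_iff_of_pos_left, hr0, hs0] at hA hB <;>
  obtain ⟨a, b, rfl, rfl, hy⟩ := exists_sq_of_isCoprime_of_pos hc hA hB h2 <;>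
  refine ⟨a, b, hy, ?_⟩
  · exact .inr (.inr (.inr ⟨by ring, rfl⟩))
  · exact .inr (.inl ⟨rfl, rfl⟩)
  · exact .inr (.inr (.inl ⟨rfl, rfl⟩))
  · exact .inl ⟨rfl, by ring⟩

theorem pell_pq {p q : ℕ} [Fact p.Prime] [Fact q.Prime]
    (hp : p % 8 = 5) (hq : q % 8 = 3) (hleg : legendreSym q (p : ℤ) = 1) {x y : ℤ}
    (hx : 1 < x) (h : x ^ 2 - (p * q : ℕ) * y ^ 2 = 1) :
    (∃ a b : ℤ, x = p * a ^ 2 + q * b ^ 2 ∧ y = 2 * (a * b)) ∨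
      (∃ a b : ℤ, x = a ^ 2 + (p * q : ℕ) * b ^ 2 ∧ y = 2 * (a * b)) := by
  obtain ⟨⟨hq1, hq2⟩, hp1, hp2, hpq⟩ := legendreSym_values hp hq hleg
  have hpp : Prime (p : ℤ) := Nat.prime_iff_prime_int.1 Fact.out
  have hqq : Prime (q : ℤ) := Nat.prime_iff_prime_int.1 Fact.out
  have hp0 : (0 : ℤ) < p := by omega
  have hq0 : (0 : ℤ) < q := by omega
  push_cast at h ⊢
  obtain ⟨A, rfl | rfl⟩ := Int.even_or_odd' x
  · exfalso
    obtain ⟨a, b, -, ⟨hA, hB⟩ | ⟨hA, hB⟩ | ⟨hA, hB⟩ | ⟨hA, hB⟩⟩ :=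
      exists_sq_of_mul_eq_mul_sq (A := 2 * A + 1) (B := 2 * A - 1) (y := y) hpp hqq hp0 hq0
        ⟨A, -A - 1, by ring⟩ (by omega) (by omega) (by linear_combination h)
    · exact not_dvd_sq_sub hq2 a ⟨p * b ^ 2, by linear_combination hB - hA⟩
    · refine not_dvd_sq_sub (r := q) (n := 2 * p) ?_ (p * a)
        ⟨p * b ^ 2, by linear_combination p * (hB - hA)⟩
      rw [legendreSym.mul, hq2, hleg, mul_one]
    · refine not_dvd_sq_sub (r := p) (n := 2 * q) ?_ (q * a)
        ⟨q * b ^ 2, by linear_combination q * (hB - hA)⟩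
      rw [legendreSym.mul, hp2, hpq, mul_one]
    · refine not_dvd_sq_sub (r := p) (n := -1 * 2) ?_ b
        ⟨q * a ^ 2, by linear_combination hA - hB⟩
      rw [legendreSym.mul, hp2, hp1, one_mul]
  · obtain ⟨B, rfl | rfl⟩ := Int.even_or_odd' y
    · obtain ⟨a, b, rfl, ⟨hA, hB⟩ | ⟨hA, hB⟩ | ⟨hA, hB⟩ | ⟨hA, hB⟩⟩ :=
        exists_sq_of_mul_eq_mul_sq (A := A + 1) (B := A) (y := B) hpp hqq hp0 hq0
          (isCoprime_add_one A) (by omega) (by omega)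
          (mul_left_cancel₀ (four_ne_zero (α := ℤ)) (by linear_combination h))
      · exact .inr ⟨a, b, by linear_combination hA + hB, rfl⟩
      · exact .inl ⟨a, b, by linear_combination hA + hB, rfl⟩
      · refine (not_dvd_sq_sub (r := q) (n := -1 * p) ?_ (p * b)
          ⟨p * a ^ 2, by linear_combination p * (hA - hB)⟩).elim
        rw [legendreSym.mul, hq1, hleg, mul_one]
      · exact (not_dvd_sq_sub hq1 b ⟨p * a ^ 2, by linear_combination hA - hB⟩).elim
    · exfalso
      have hodd : Odd ((p : ℤ) * q * (2 * B + 1) ^ 2) :=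
        ((Int.odd_iff.2 (by omega)).mul (Int.odd_iff.2 (by omega))).mul (odd_two_mul_add_one B).pow
      rw [show (p : ℤ) * q * (2 * B + 1) ^ 2 = 2 * (2 * A ^ 2 + 2 * A) by linear_combination -h]
        at hodd
      exact (Int.not_odd_iff_even.2 (even_two_mul _)) hodd

theorem pell_two_mul_pq {p q : ℕ} [Fact p.Prime] [Fact q.Prime]
    (hp : p % 8 = 5) (hq : q % 8 = 3) (hleg : legendreSym q (p : ℤ) = 1) {x y : ℤ}
    (hx : 1 < x) (h : x ^ 2 - (2 * p * q : ℕ) * y ^ 2 = 1) :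
    (∃ a b : ℤ, x = q * a ^ 2 + 2 * p * b ^ 2 ∧ y = 2 * (a * b)) ∨
      (∃ a b : ℤ, x = a ^ 2 + (2 * p * q : ℕ) * b ^ 2 ∧ y = 2 * (a * b)) := by
  obtain ⟨⟨hq1, hq2⟩, hp1, hp2, hpq⟩ := legendreSym_values hp hq hleg
  have hpp : Prime (p : ℤ) := Nat.prime_iff_prime_int.1 Fact.out
  have hqq : Prime (q : ℤ) := Nat.prime_iff_prime_int.1 Fact.out
  have hp0 : (0 : ℤ) < p := by omega
  have hq0 : (0 : ℤ) < q := by omega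
  push_cast at h ⊢
  obtain ⟨A, rfl | rfl⟩ := Int.even_or_odd' x
  · exfalso
    have : 2 * (2 * A ^ 2 - p * q * y ^ 2) = 1 := by linear_combination h
    omega
  obtain ⟨B, rfl | rfl⟩ := Int.even_or_odd' y
  swap
  · exfalso
    have hodd : Odd ((p : ℤ) * q * (2 * B + 1) ^ 2) :=
      ((Int.odd_iff.2 (by omega)).mul (Int.odd_iff.2 (by omega))).mul (odd_two_mul_add_one B).pow
    rw [show (p : ℤ) * q * (2 * B + 1) ^ 2 = 2 * (A ^ 2 + A) from
      mul_left_cancel₀ (two_ne_zero (α := ℤ)) (by linear_combination -h)] at hodd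
    exact (Int.not_odd_iff_even.2 (even_two_mul _)) hodd
  have hAB : (A + 1) * A = 2 * (p * (q * B ^ 2)) :=
    mul_left_cancel₀ (four_ne_zero (α := ℤ)) (by linear_combination h)
  have hA0 : 0 < A := by omega
  rcases exists_mul_of_prime_of_isCoprime Int.prime_two (isCoprime_add_one A) hAB with
    ⟨C, hC, hc, h1⟩ | ⟨C, hC, hc, h1⟩
  · exfalso
    obtain ⟨a, b, rfl, ⟨hA, hB⟩ | ⟨hA, hB⟩ | ⟨hA, hB⟩ | ⟨hA, hB⟩⟩ :=
      exists_sq_of_mul_eq_mul_sq hpp hqq hp0 hq0 hc (by omega) hA0 h1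
    · refine not_dvd_sq_sub hq2 (2 * a) ⟨2 * p * b ^ 2, by linear_combination 2 * (hB - hC - 2 * hA)⟩
    · refine not_dvd_sq_sub (r := q) (n := 2 * p) ?_ (2 * p * a)
        ⟨2 * p * b ^ 2, by linear_combination 2 * p * (hB - hC - 2 * hA)⟩
      rw [legendreSym.mul, hq2, hleg, mul_one]
    · refine not_dvd_sq_sub (r := p) (n := 2 * q) ?_ (2 * q * a)
        ⟨2 * q * b ^ 2, by linear_combination 2 * q * (hB - hC - 2 * hA)⟩
      rw [legendreSym.mul, hp2, hpq, mul_one]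
    · exact not_dvd_sq_sub hq1 b ⟨2 * p * a ^ 2, by linear_combination hC + 2 * hA - hB⟩
  · obtain ⟨a, b, rfl, ⟨hA, hB⟩ | ⟨hA, hB⟩ | ⟨hA, hB⟩ | ⟨hA, hB⟩⟩ :=
      exists_sq_of_mul_eq_mul_sq hpp hqq hp0 hq0 hc (by omega) (by omega) h1
    · exact .inr ⟨a, b, by linear_combination hA + hC + 2 * hB, rfl⟩
    · refine (not_dvd_sq_sub (r := p) (n := -1 * (2 * q)) ?_ (2 * q * b)
        ⟨2 * q * a ^ 2, by linear_combination 2 * q * (hA - hC - 2 * hB)⟩).elim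
      rw [legendreSym.mul, legendreSym.mul, hp1, hp2, hpq]; rfl
    · exact .inl ⟨a, b, by linear_combination hA + hC + 2 * hB, rfl⟩
    · refine (not_dvd_sq_sub (r := p) (n := -1 * 2) ?_ (2 * b)
        ⟨2 * q * a ^ 2, by linear_combination 2 * (hA - hC - 2 * hB)⟩).elim
      rw [legendreSym.mul, hp1, hp2, one_mul]

section Units

variable {K : IntermediateField ℚ ℝ}

theorem uval_mul (u v : (integralClosure ℤ K)ˣ) : uval (u * v) = uval u * uval v := by
  simp [uval]

theorem uval_neg (u : (integralClosure ℤ K)ˣ) : uval (-u) = -uval u := by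
  simp [uval]

theorem uval_one : uval (1 : (integralClosure ℤ K)ˣ) = 1 := by
  simp [uval]

theorem uval_ne_zero (u : (integralClosure ℤ K)ˣ) : uval u ≠ 0 := fun h => by
  have := uval_mul u u⁻¹
  rw [mul_inv_cancel, uval_one, h, zero_mul] at this
  exact one_ne_zero this

theorem uval_inv (u : (integralClosure ℤ K)ˣ) : uval u⁻¹ = (uval u)⁻¹ :=
  eq_inv_of_mul_eq_one_left (by rw [← uval_mul, inv_mul_cancel, uval_one])

theorem uval_pow (u : (integralClosure ℤ K)ˣ) (n : ℕ) : uval (u ^ n) = uval u ^ n := by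
  simp [uval]

theorem uval_zpow (u : (integralClosure ℤ K)ˣ) : ∀ n : ℤ, uval (u ^ n) = uval u ^ n
  | .ofNat n => by simpa using uval_pow u n
  | .negSucc n => by simp only [zpow_negSucc, uval_inv, uval_pow]

theorem uval_injective : Function.Injective (uval (K := K)) := fun _ _ h =>
  Units.ext (Subtype.ext (Subtype.ext h))

theorem uval_mem (u : (integralClosure ℤ K)ˣ) : uval u ∈ K :=
  ((u : integralClosure ℤ K) : K).2

theorem isIntegral_coe_iff {x : K} : IsIntegral ℤ (x : ℝ) ↔ IsIntegral ℤ x :=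
  isIntegral_algebraMap_iff (algebraMap K ℝ).injective

theorem isIntegral_uval (u : (integralClosure ℤ K)ˣ) : IsIntegral ℤ (uval u) :=
  isIntegral_coe_iff.2 (u : integralClosure ℤ K).2

theorem exists_uval_eq {x y : ℝ} (hx : x ∈ K) (hxi : IsIntegral ℤ x) (hyi : IsIntegral ℤ y)
    (hxy : x * y = 1) : ∃ u : (integralClosure ℤ K)ˣ, uval u = x := by
  have hy : y ∈ K := by
    rw [eq_inv_of_mul_eq_one_right hxy]
    exact K.inv_mem hx
  exact ⟨⟨⟨⟨x, hx⟩, isIntegral_coe_iff.1 hxi⟩, ⟨⟨y, hy⟩, isIntegral_coe_iff.1 hyi⟩,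
    Subtype.ext (Subtype.ext hxy), Subtype.ext (Subtype.ext ((mul_comm y x).trans hxy))⟩, rfl⟩

end Units

theorem sqrt_mem_QF (d : ℕ) : √(d : ℝ) ∈ QF d :=
  IntermediateField.subset_adjoin ℚ _ rfl

theorem isIntegral_sqrt (d : ℕ) : IsIntegral ℤ √(d : ℝ) :=
  .of_pow two_pos (by
    rw [Real.sq_sqrt d.cast_nonneg]
    exact_mod_cast isIntegral_algebraMap (R := ℤ) (A := ℝ) (x := (d : ℤ)))

theorem isIntegral_int_add_mul_sqrt (d : ℕ) (a b : ℤ) : IsIntegral ℤ ((a : ℝ) + b * √d) :=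
  isIntegral_algebraMap.add (isIntegral_algebraMap.mul (isIntegral_sqrt d))

theorem ratCast_mem_intermediateField (F : IntermediateField ℚ ℝ) (a : ℚ) : (a : ℝ) ∈ F :=
  F.algebraMap_mem a

theorem rat_add_mul_sqrt_mem_QF (d : ℕ) (a b : ℚ) : (a : ℝ) + b * √d ∈ QF d :=
  add_mem (ratCast_mem_intermediateField _ a)
    (mul_mem (ratCast_mem_intermediateField _ b) (sqrt_mem_QF d))

theorem exists_eq_of_mem_QF {d : ℕ} {x : ℝ} (hx : x ∈ QF d) :
    ∃ a b : ℚ, x = a + b * √d := by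
  rw [QF, ← IntermediateField.mem_toSubalgebra,
    IntermediateField.adjoin_toSubalgebra_of_isAlgebraic
      (by rintro y rfl; exact (isIntegral_sqrt d).tower_top.isAlgebraic)] at hx
  have hd := Real.mul_self_sqrt (d.cast_nonneg (α := ℝ))
  induction hx using Algebra.adjoin_induction with
  | mem y hy => exact ⟨0, 1, by rw [hy]; simp⟩
  | algebraMap r => exact ⟨r, 0, by simp⟩
  | add y z _ _ hy hz =>
    obtain ⟨a, b, rfl⟩ := hy
    obtain ⟨a', b', rfl⟩ := hz
    exact ⟨a + a', b + b', by push_cast; ring⟩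
  | mul y z _ _ hy hz =>
    obtain ⟨a, b, rfl⟩ := hy
    obtain ⟨a', b', rfl⟩ := hz
    exact ⟨a * a' + b * b' * d, a * b' + a' * b, by
      push_cast; linear_combination (b : ℝ) * b' * hd⟩

theorem exists_eq_of_mem_K2 {d e : ℕ} {x : ℝ} (hx : x ∈ K2 d e) :
    ∃ α ∈ QF d, ∃ β ∈ QF d, x = α + β * √e := by
  rw [K2, ← IntermediateField.mem_toSubalgebra,
    IntermediateField.adjoin_toSubalgebra_of_isAlgebraic
      (by rintro y (rfl | rfl) <;> exact (isIntegral_sqrt _).tower_top.isAlgebraic)] at hx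
  have he := Real.mul_self_sqrt (e.cast_nonneg (α := ℝ))
  induction hx using Algebra.adjoin_induction with
  | mem y hy =>
    rcases hy with rfl | rfl
    · exact ⟨_, sqrt_mem_QF d, 0, zero_mem _, by simp⟩
    · exact ⟨0, zero_mem _, 1, one_mem _, by simp⟩
  | algebraMap r => exact ⟨_, ratCast_mem_intermediateField _ r, 0, zero_mem _, by simp⟩
  | add y z _ _ hy hz =>
    obtain ⟨a, ha, b, hb, rfl⟩ := hy
    obtain ⟨a', ha', b', hb', rfl⟩ := hz
    exact ⟨a + a', add_mem ha ha', b + b', add_mem hb hb', by ring⟩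
  | mul y z _ _ hy hz =>
    obtain ⟨a, ha, b, hb, rfl⟩ := hy
    obtain ⟨a', ha', b', hb', rfl⟩ := hz
    exact ⟨a * a' + b * b' * e, add_mem (mul_mem ha ha') (mul_mem (mul_mem hb hb') (natCast_mem _ e)),
      a * b' + a' * b, add_mem (mul_mem ha hb') (mul_mem ha' hb), by
      linear_combination b * b' * he⟩

theorem sqrt_mul_sqrt_natCast (d e : ℕ) : √(d : ℝ) * √(e : ℝ) = √((d * e : ℕ) : ℝ) := by
  rw [Nat.cast_mul, Real.sqrt_mul d.cast_nonneg]

theorem sqrt_not_mem_QF {d e : ℕ} (hd : ¬ IsSquare d) (he : ¬ IsSquare e)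
    (hde : ¬ IsSquare (d * e)) : √(e : ℝ) ∉ QF d := fun h => by
  rw [← irrational_sqrt_natCast_iff] at hd he hde
  obtain ⟨a, b, hab⟩ := exists_eq_of_mem_QF h
  have hd2 := Real.mul_self_sqrt (d.cast_nonneg (α := ℝ))
  have he2 := Real.mul_self_sqrt (e.cast_nonneg (α := ℝ))
  have key : (e : ℝ) = (a ^ 2 + d * b ^ 2) + 2 * a * b * √d := by
    rw [← he2, hab]; linear_combination (b : ℝ) ^ 2 * hd2
  by_cases hab0 : a * b = 0
  · rcases mul_eq_zero.1 hab0 with rfl | rfl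
    · refine hde ⟨b * d, ?_⟩
      rw [← sqrt_mul_sqrt_natCast, hab]
      push_cast
      linear_combination -(b : ℝ) * hd2
    · exact he ⟨a, by simp [hab]⟩
  · refine hd ⟨(e - (a ^ 2 + d * b ^ 2)) / (2 * (a * b)), ?_⟩
    have : (a : ℝ) * b ≠ 0 := by exact_mod_cast hab0
    push_cast
    rw [div_eq_iff (by simpa using this)]
    linear_combination key

/-- The nontrivial automorphism `α + β s ↦ α - β s` of a field `L` quadratic over `F`. -/
theorem exists_conj {F L : IntermediateField ℚ ℝ} {s : ℝ} (hs : s * s ∈ F) (hsF : s ∉ F)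
    (hL : ∀ x ∈ L, ∃ α ∈ F, ∃ β ∈ F, x = α + β * s) :
    ∃ σ : L →+* ℝ, ∀ x : L, ∀ α ∈ F, ∀ β ∈ F, (x : ℝ) = α + β * s → σ x = α - β * s := by
  have huniq : ∀ α ∈ F, ∀ β ∈ F, ∀ α' ∈ F, ∀ β' ∈ F, α + β * s = α' + β' * s →
      α - β * s = α' - β' * s := by
    intro α hα β hβ α' hα' β' hβ' h
    have hβ0 : β - β' = 0 := by
      by_contra hne
      refine hsF ?_
      rw [show s = (α' - α) / (β - β') by rw [eq_div_iff hne]; linear_combination h]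
      exact div_mem (sub_mem hα' hα) (sub_mem hβ hβ')
    linear_combination h - 2 * s * hβ0
  choose f hf g hg hfg using fun x : L => hL x x.2
  have key : ∀ x : L, ∀ α ∈ F, ∀ β ∈ F, (x : ℝ) = α + β * s → f x - g x * s = α - β * s :=
    fun x α hα β hβ h => huniq _ (hf x) _ (hg x) _ hα _ hβ ((hfg x).symm.trans h)
  refine ⟨{ toFun := fun x => f x - g x * s, map_one' := ?_, map_mul' := ?_, map_zero' := ?_,
            map_add' := ?_ }, key⟩
  · simpa using key 1 1 (one_mem _) 0 (zero_mem _) (by simp)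
  · intro x y
    rw [key (x * y) (f x * f y + g x * g y * (s * s))
      (add_mem (mul_mem (hf x) (hf y)) (mul_mem (mul_mem (hg x) (hg y)) hs))
      (f x * g y + f y * g x) (add_mem (mul_mem (hf x) (hg y)) (mul_mem (hf y) (hg x)))
      (by push_cast; rw [hfg x, hfg y]; ring)]
    ring
  · simpa using key 0 0 (zero_mem _) 0 (zero_mem _) (by simp)
  · intro x y
    rw [key (x + y) (f x + f y) (add_mem (hf x) (hf y)) (g x + g y) (add_mem (hg x) (hg y))
      (by push_cast; rw [hfg x, hfg y]; ring)]
    ring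

theorem isIntegral_ringHom_of_coe {L : IntermediateField ℚ ℝ} (σ : L →+* ℝ) {x : L}
    (hx : IsIntegral ℤ (x : ℝ)) : IsIntegral ℤ (σ x) :=
  (isIntegral_coe_iff.1 hx).map σ.toIntAlgHom

theorem exists_conj_QF {d : ℕ} (hd : ¬ IsSquare d) :
    ∃ σ : QF d →+* ℝ, ∀ x : QF d, ∀ a b : ℚ, (x : ℝ) = a + b * √d → σ x = a - b * √d := by
  obtain ⟨σ, hσ⟩ := exists_conj (F := ⊥) (L := QF d) (s := √d)
    (by rw [Real.mul_self_sqrt d.cast_nonneg]; exact natCast_mem _ d)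
    (by
      rintro h
      obtain ⟨a, ha⟩ := IntermediateField.mem_bot.1 h
      exact irrational_sqrt_natCast_iff.2 hd ⟨a, by simpa using ha⟩)
    (fun x hx => by
      obtain ⟨a, b, rfl⟩ := exists_eq_of_mem_QF hx
      exact ⟨a, ratCast_mem_intermediateField _ a, b, ratCast_mem_intermediateField _ b, rfl⟩)
  exact ⟨σ, fun x a b h => hσ x a (ratCast_mem_intermediateField _ a) b
    (ratCast_mem_intermediateField _ b) h⟩

theorem exists_int_of_isIntegral_ratCast {r : ℚ} (h : IsIntegral ℤ (r : ℝ)) :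
    ∃ n : ℤ, r = n := by
  have h' : IsIntegral ℤ r :=
    (isIntegral_algebraMap_iff (A := ℚ) (B := ℝ) (algebraMap ℚ ℝ).injective).1 (by simpa using h)
  obtain ⟨n, hn⟩ := IsIntegrallyClosed.isIntegral_iff.1 h'
  exact ⟨n, by simpa using hn.symm⟩

theorem exists_int_of_squarefree_mul_sq {d : ℕ} (hd : Squarefree d) {r : ℚ} {n : ℤ}
    (h : d * r ^ 2 = n) : ∃ k : ℤ, r = k := by
  have h1 : (d : ℤ) * r.num ^ 2 = n * (r.den : ℤ) ^ 2 := by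
    have hr := r.num_div_den
    have hden : (r.den : ℚ) ≠ 0 := by exact_mod_cast r.den_nz
    rw [← hr] at h
    field_simp at h
    rw [mul_comm (n : ℤ)]
    exact_mod_cast h
  have hc : IsCoprime ((r.den : ℤ) ^ 2) (r.num ^ 2) :=
    (Int.isCoprime_iff_gcd_eq_one.2 (by
      simpa [Int.gcd, Nat.gcd_comm] using r.reduced.gcd_eq_one)).pow
  have h2 : r.den * r.den ∣ d := by
    have := hc.dvd_of_dvd_mul_right (Dvd.intro_left _ h1.symm)
    rw [← pow_two]
    exact_mod_cast this
  have h3 : r.den = 1 := Nat.isUnit_iff.1 (hd _ h2)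
  exact ⟨r.num, (Rat.coe_int_num_of_den_eq_one h3).symm⟩

theorem unit_norm {d : ℕ} (hd : ¬ IsSquare d) (u : (integralClosure ℤ (QF d))ˣ) {a b : ℚ}
    (h : uval u = a + b * √d) :
    IsIntegral ℤ ((a : ℝ) - b * √d) ∧ (a ^ 2 - d * b ^ 2 = 1 ∨ a ^ 2 - d * b ^ 2 = -1) := by
  obtain ⟨σ, hσ⟩ := exists_conj_QF hd
  have hs := Real.sq_sqrt (d.cast_nonneg (α := ℝ))
  have key : ∀ (v : (integralClosure ℤ (QF d))ˣ) {a b : ℚ}, uval v = a + b * √d →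
      IsIntegral ℤ ((a : ℝ) - b * √d) ∧ ∃ n : ℤ, a ^ 2 - d * b ^ 2 = n := by
    intro v a b hv
    have h1 : IsIntegral ℤ ((a : ℝ) - b * √d) := by
      rw [← hσ _ a b hv]
      exact isIntegral_ringHom_of_coe σ (isIntegral_uval v)
    refine ⟨h1, exists_int_of_isIntegral_ratCast ?_⟩
    have h2 := (isIntegral_uval v).mul h1
    rw [hv] at h2
    rwa [show ((a ^ 2 - d * b ^ 2 : ℚ) : ℝ) = (a + b * √d) * (a - b * √d) by
      push_cast; linear_combination (b : ℝ) ^ 2 * hs]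
  obtain ⟨a', b', h'⟩ := exists_eq_of_mem_QF (uval_mem u⁻¹)
  obtain ⟨hi, n, hn⟩ := key u h
  obtain ⟨-, n', hn'⟩ := key u⁻¹ h'
  refine ⟨hi, ?_⟩
  have hmul : uval u * uval u⁻¹ = 1 := by rw [uval_inv, mul_inv_cancel₀ (uval_ne_zero u)]
  have hσmul : ((a : ℝ) - b * √d) * (a' - b' * √d) = 1 := by
    rw [← hσ ⟨_, uval_mem u⟩ a b h, ← hσ ⟨_, uval_mem u⁻¹⟩ a' b' h', ← map_mul, ← map_one σ]
    exact congrArg σ (Subtype.ext hmul)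
  have hprod : (n : ℝ) * n' = 1 := by
    have e1 : (n : ℝ) = a ^ 2 - d * b ^ 2 := by exact_mod_cast hn.symm
    have e2 : (n' : ℝ) = a' ^ 2 - d * b' ^ 2 := by exact_mod_cast hn'.symm
    rw [h, h'] at hmul
    have e3 : (n : ℝ) = (a + b * √d) * (a - b * √d) := by
      rw [e1]; linear_combination (b : ℝ) ^ 2 * hs
    have e4 : (n' : ℝ) = (a' + b' * √d) * (a' - b' * √d) := by
      rw [e2]; linear_combination (b' : ℝ) ^ 2 * hs
    rw [e3, e4]
    linear_combination ((a : ℝ) - b * √d) * (a' - b' * √d) * hmul + hσmul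
  rcases Int.eq_one_or_neg_one_of_mul_eq_one (u := n) (v := n') (by exact_mod_cast hprod)
    with rfl | rfl
  · exact .inl (by exact_mod_cast hn)
  · exact .inr (by exact_mod_cast hn)

theorem not_isSquare_of_mod_four {d : ℕ} (hd : d % 4 = 2 ∨ d % 4 = 3) : ¬ IsSquare d := by
  rintro ⟨k, rfl⟩
  have : k % 4 < 4 := Nat.mod_lt _ (by norm_num)
  rw [Nat.mul_mod] at hd
  interval_cases k % 4 <;> simp_all

theorem exists_int_coords {d : ℕ} (hd : d % 4 = 2 ∨ d % 4 = 3) (hsf : Squarefree d)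
    (u : (integralClosure ℤ (QF d))ˣ) :
    ∃ x y : ℤ, uval u = x + y * √d ∧ (x ^ 2 - d * y ^ 2 = 1 ∨ x ^ 2 - d * y ^ 2 = -1) := by
  obtain ⟨a, b, h⟩ := exists_eq_of_mem_QF (uval_mem u)
  obtain ⟨hi, hN⟩ := unit_norm (not_isSquare_of_mod_four hd) u h
  obtain ⟨A, hA⟩ := exists_int_of_isIntegral_ratCast (r := 2 * a) (by
    have := (isIntegral_uval u).add hi
    rw [h] at this
    rwa [show ((2 * a : ℚ) : ℝ) = a + b * √d + (a - b * √d) by push_cast; ring])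
  obtain ⟨n, hn⟩ : ∃ n : ℤ, a ^ 2 - d * b ^ 2 = n := by
    rcases hN with hN | hN
    exacts [⟨1, by simpa using hN⟩, ⟨-1, by simpa using hN⟩]
  obtain ⟨B, hB⟩ := exists_int_of_squarefree_mul_sq hsf (r := 2 * b) (n := A ^ 2 - 4 * n) (by
    push_cast
    rw [← hA, ← hn]
    ring)
  have hAB : A ^ 2 - d * B ^ 2 = 4 * n := by
    have : (A : ℚ) ^ 2 - d * B ^ 2 = 4 * n := by rw [← hA, ← hB, ← hn]; ring
    exact_mod_cast this
  have hpar : A % 2 = 0 ∧ B % 2 = 0 := by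
    obtain ⟨k, r, hk, hr⟩ : ∃ k r : ℤ, (d : ℤ) = 4 * k + r ∧ (r = 2 ∨ r = 3) :=
      ⟨d / 4, d % 4, by omega, by omega⟩
    rw [hk] at hAB
    rcases Int.even_or_odd' A with ⟨A, rfl | rfl⟩ <;> rcases Int.even_or_odd' B with ⟨B, rfl | rfl⟩
    · omega
    · have : 4 * (A ^ 2 - k * (2 * B + 1) ^ 2 - r * (B ^ 2 + B) - n) = r := by
        linear_combination hAB
      omega
    · have : 4 * (A ^ 2 + A - (4 * k + r) * B ^ 2 - n) = -1 := by linear_combination hAB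
      omega
    · have : 4 * (A ^ 2 + A - k * (2 * B + 1) ^ 2 - r * (B ^ 2 + B) - n) = r - 1 := by
        linear_combination hAB
      omega
  obtain ⟨x, rfl⟩ : ∃ x, A = 2 * x := ⟨A / 2, by omega⟩
  obtain ⟨y, rfl⟩ : ∃ y, B = 2 * y := ⟨B / 2, by omega⟩
  obtain rfl : a = x := by push_cast at hA; linarith
  obtain rfl : b = y := by push_cast at hB; linarith
  exact ⟨x, y, by simpa using h, by exact_mod_cast hN⟩

theorem QF_le {d : ℕ} {L : IntermediateField ℚ ℝ} (h : √(d : ℝ) ∈ L) : QF d ≤ L :=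
  IntermediateField.adjoin_le_iff.2 (by rintro _ rfl; exact h)

theorem exists_uval_eq_of_le {F L : IntermediateField ℚ ℝ} (h : F ≤ L)
    (u : (integralClosure ℤ F)ˣ) : ∃ v : (integralClosure ℤ L)ˣ, uval v = uval u :=
  exists_uval_eq (h (uval_mem u)) (isIntegral_uval u) (isIntegral_uval u⁻¹)
    (by rw [uval_inv, mul_inv_cancel₀ (uval_ne_zero u)])

/-- The relative norm of a unit to a subfield of index two is a unit. -/
theorem exists_uval_eq_mul_conj {F L : IntermediateField ℚ ℝ} {s : ℝ} (hs : s * s ∈ F)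
    (hL : ∀ x ∈ L, ∃ α ∈ F, ∃ β ∈ F, x = α + β * s) {σ : L →+* ℝ}
    (hσ : ∀ x : L, ∀ α ∈ F, ∀ β ∈ F, (x : ℝ) = α + β * s → σ x = α - β * s)
    (u : (integralClosure ℤ L)ˣ) :
    ∃ v : (integralClosure ℤ F)ˣ, uval v = uval u * σ ⟨uval u, uval_mem u⟩ := by
  have hint : ∀ w : (integralClosure ℤ L)ˣ,
      IsIntegral ℤ (uval w * σ ⟨uval w, uval_mem w⟩) := fun w =>
    (isIntegral_uval w).mul (isIntegral_ringHom_of_coe σ (isIntegral_uval w))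
  have hmul : uval u * uval u⁻¹ = 1 := by rw [uval_inv, mul_inv_cancel₀ (uval_ne_zero u)]
  have hσmul : σ ⟨uval u, uval_mem u⟩ * σ ⟨uval u⁻¹, uval_mem u⁻¹⟩ = 1 := by
    rw [← map_mul, ← map_one σ]
    exact congrArg σ (Subtype.ext hmul)
  refine exists_uval_eq ?_ (hint u) (hint u⁻¹) (by
    linear_combination hσmul +
      hmul * (σ ⟨uval u, uval_mem u⟩ * σ ⟨uval u⁻¹, uval_mem u⁻¹⟩))
  obtain ⟨α, hα, β, hβ, h⟩ := hL _ (uval_mem u)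
  rw [hσ ⟨_, uval_mem u⟩ α hα β hβ h, h,
    show (α + β * s) * (α - β * s) = α * α - β * β * (s * s) by ring]
  exact sub_mem (mul_mem hα hα) (mul_mem (mul_mem hβ hβ) hs)

namespace IsFundUnit

variable {d : ℕ} {t : ℝ}

theorem one_lt (h : IsFundUnit d t) : 1 < t := h.choose_spec.2.1

theorem exists_zpow (h : IsFundUnit d t) (v : (integralClosure ℤ (QF d))ˣ) :
    ∃ n : ℤ, uval v = t ^ n ∨ uval v = -t ^ n := by
  obtain ⟨ε, rfl, -, h⟩ := h
  obtain ⟨n, rfl | rfl⟩ := h v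
  · exact ⟨n, .inl (uval_zpow ε n)⟩
  · exact ⟨n, .inr (by rw [uval_neg, uval_zpow])⟩

theorem exists_abs_eq_zpow (h : IsFundUnit d t) (v : (integralClosure ℤ (QF d))ˣ) :
    ∃ n : ℤ, |uval v| = t ^ n := by
  have h0 := one_lt h
  obtain ⟨n, hn | hn⟩ := h.exists_zpow v <;>
    exact ⟨n, by rw [hn]; simp [abs_of_pos (zero_lt_one.trans h0)]⟩

theorem not_sq (h : IsFundUnit d t) (v : (integralClosure ℤ (QF d))ˣ) : uval v ^ 2 ≠ t := by
  intro hv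
  obtain ⟨n, hn⟩ := h.exists_abs_eq_zpow v
  rw [← sq_abs, hn, ← zpow_natCast, ← zpow_mul] at hv
  have := zpow_right_injective₀ (zero_lt_one.trans h.one_lt) h.one_lt.ne'
    (hv.trans (zpow_one t).symm)
  push_cast at this
  omega

theorem exists_pell (h : IsFundUnit d t) (hd : d % 4 = 2 ∨ d % 4 = 3) (hsf : Squarefree d)
    (hneg : ∀ x y : ℤ, x ^ 2 - d * y ^ 2 ≠ -1) :
    ∃ x y : ℤ, t = x + y * √d ∧ x ^ 2 - d * y ^ 2 = 1 ∧ 1 < x ∧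
      ¬ ∃ a b : ℤ, x = a ^ 2 + d * b ^ 2 ∧ y = 2 * (a * b) := by
  have hs := Real.sq_sqrt (d.cast_nonneg (α := ℝ))
  have h1 := h.one_lt
  obtain ⟨ε, hε, -⟩ := id h
  obtain ⟨x, y, hxy, hN⟩ := exists_int_coords hd hsf ε
  replace hN := hN.resolve_right (hneg x y)
  rw [hε] at hxy
  have hNR : (x : ℝ) ^ 2 - d * y ^ 2 = 1 := by exact_mod_cast hN
  have hconj : t * (x - y * √d) = 1 := by
    rw [hxy]; linear_combination hNR - (y : ℝ) ^ 2 * hs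
  refine ⟨x, y, hxy, hN, ?_, ?_⟩
  · have : (1 : ℝ) < x := by nlinarith
    exact_mod_cast this
  · rintro ⟨a, b, rfl, rfl⟩
    have hsq : ((a : ℝ) + b * √d) ^ 2 = t := by
      rw [hxy]; push_cast; linear_combination (b : ℝ) ^ 2 * hs
    obtain ⟨v, hv⟩ := exists_uval_eq (K := QF d)
      (by simpa using rat_add_mul_sqrt_mem_QF d a b)
      (isIntegral_int_add_mul_sqrt d a b)
      ((isIntegral_int_add_mul_sqrt d a b).mul (isIntegral_uval ε⁻¹))
      (by rw [← mul_assoc, ← pow_two, hsq, uval_inv, hε, mul_inv_cancel₀ (by linarith)])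
    exact h.not_sq v (by rw [hv, hsq])

theorem two_norm (h : IsFundUnit 2 t) :
    ∃ x y : ℤ, t = x + y * √(2 : ℕ) ∧ x ^ 2 - 2 * y ^ 2 = -1 := by
  have hs := Real.sq_sqrt ((2 : ℕ).cast_nonneg (α := ℝ))
  obtain ⟨ε, hε, -⟩ := id h
  obtain ⟨x, y, hxy, hN⟩ := exists_int_coords (by norm_num) Nat.prime_two.squarefree ε
  rw [hε] at hxy
  refine ⟨x, y, hxy, hN.resolve_left fun hN => ?_⟩
  have hNR : (x : ℝ) ^ 2 - (2 : ℕ) * y ^ 2 = 1 := by exact_mod_cast hN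
  obtain ⟨σ, hσ⟩ := exists_conj_QF (not_isSquare_of_mod_four (d := 2) (by norm_num))
  obtain ⟨v, hv⟩ := exists_uval_eq (K := QF 2) (x := ((1 : ℤ) : ℝ) + (1 : ℤ) * √(2 : ℕ))
    (y := ((-1 : ℤ) : ℝ) + (1 : ℤ) * √(2 : ℕ))
    (by simpa using rat_add_mul_sqrt_mem_QF 2 1 1)
    (isIntegral_int_add_mul_sqrt 2 1 1) (isIntegral_int_add_mul_sqrt 2 (-1) 1)
    (by push_cast at hs ⊢; linear_combination hs)
  obtain ⟨n, hn⟩ := h.exists_zpow v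
  let T : QF 2 := ⟨uval ε, uval_mem ε⟩
  let W : QF 2 := ⟨uval v, uval_mem v⟩
  have hT : t * σ T = 1 := by
    rw [hσ T x y (by simpa [T] using hε.trans hxy), hxy]
    push_cast at hNR hs ⊢
    linear_combination hNR - (y : ℝ) ^ 2 * hs
  have hW : uval v * σ W = -1 := by
    rw [hσ W 1 1 (by simpa [W] using hv), hv]
    push_cast at hs ⊢
    linear_combination -hs
  have hTn : ((T ^ n : QF 2) : ℝ) = t ^ n :=
    (map_zpow₀ (algebraMap (QF 2) ℝ) T n).trans (congrArg (· ^ n) hε)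
  have hprod : uval v * σ W = 1 := by
    rcases hn with hn | hn
    · rw [show W = T ^ n from Subtype.ext (hn.trans hTn.symm), map_zpow₀, hn, ← mul_zpow, hT,
        one_zpow]
    · rw [show W = -T ^ n from Subtype.ext (hn.trans (congrArg Neg.neg hTn.symm)), map_neg,
        map_zpow₀, hn, neg_mul_neg, ← mul_zpow, hT, one_zpow]
  linarith

end IsFundUnit

theorem exists_coords_K2 {m n : ℕ} (hmn : n = 2 * m) {x : ℝ} (hx : x ∈ K2 2 m) :
    ∃ a b c f : ℚ, x = a + b * √(2 : ℕ) + c * √m + f * √n := by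
  obtain ⟨α, hα, β, hβ, rfl⟩ := exists_eq_of_mem_K2 hx
  obtain ⟨a, b, rfl⟩ := exists_eq_of_mem_QF hα
  obtain ⟨c, f, rfl⟩ := exists_eq_of_mem_QF hβ
  exact ⟨a, b, c, f, by rw [hmn, ← sqrt_mul_sqrt_natCast]; ring⟩

theorem exists_conjs_K2 {m n : ℕ} (hmn : n = 2 * m) (hm : ¬ IsSquare m) (hn : ¬ IsSquare n) :
    ∃ σ₁ σ₂ σ₃ : K2 2 m →+* ℝ,
      (∀ (x : K2 2 m) (a b c f : ℚ), (x : ℝ) = a + b * √(2 : ℕ) + c * √m + f * √n →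
        σ₁ x = a + b * √(2 : ℕ) - c * √m - f * √n ∧
        σ₂ x = a - b * √(2 : ℕ) + c * √m - f * √n ∧
        σ₃ x = a - b * √(2 : ℕ) - c * √m + f * √n) ∧
      ∀ u : (integralClosure ℤ (K2 2 m))ˣ,
        (∃ v : (integralClosure ℤ (QF 2))ˣ, uval v = uval u * σ₁ ⟨uval u, uval_mem u⟩) ∧
        (∃ v : (integralClosure ℤ (QF m))ˣ, uval v = uval u * σ₂ ⟨uval u, uval_mem u⟩) ∧
        (∃ v : (integralClosure ℤ (QF n))ˣ, uval v = uval u * σ₃ ⟨uval u, uval_mem u⟩) := by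
  have h2 : ¬ IsSquare 2 := not_isSquare_of_mod_four (by norm_num)
  have hst : √(2 : ℕ) * √m = √n := by rw [sqrt_mul_sqrt_natCast, hmn]
  have hs := Real.mul_self_sqrt ((2 : ℕ).cast_nonneg (α := ℝ))
  have ht := Real.mul_self_sqrt (m.cast_nonneg (α := ℝ))
  have hsq : ∀ (k : ℕ) (F : IntermediateField ℚ ℝ), √(k : ℝ) * √k ∈ F := fun k F => by
    rw [Real.mul_self_sqrt k.cast_nonneg]; exact natCast_mem F k
  have hL₁ : ∀ x ∈ K2 2 m, ∃ α ∈ QF 2, ∃ β ∈ QF 2, x = α + β * √m :=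
    fun x hx => exists_eq_of_mem_K2 hx
  have hL₂ : ∀ x ∈ K2 2 m, ∃ α ∈ QF m, ∃ β ∈ QF m, x = α + β * √(2 : ℕ) := by
    intro x hx
    obtain ⟨a, b, c, f, rfl⟩ := exists_coords_K2 hmn hx
    exact ⟨_, rat_add_mul_sqrt_mem_QF m a c, _, rat_add_mul_sqrt_mem_QF m b f,
      by rw [← hst]; ring⟩
  have hL₃ : ∀ x ∈ K2 2 m, ∃ α ∈ QF n, ∃ β ∈ QF n, x = α + β * √(2 : ℕ) := by
    intro x hx
    obtain ⟨a, b, c, f, rfl⟩ := exists_coords_K2 hmn hx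
    refine ⟨_, rat_add_mul_sqrt_mem_QF n a f, _, rat_add_mul_sqrt_mem_QF n b (c / 2), ?_⟩
    rw [← hst]
    push_cast at hs ⊢
    linear_combination -((c : ℝ) / 2 * √m) * hs
  obtain ⟨σ₁, hσ₁⟩ := exists_conj (hsq m _)
    (sqrt_not_mem_QF h2 hm (by rwa [← hmn])) hL₁
  obtain ⟨σ₂, hσ₂⟩ := exists_conj (hsq 2 _)
    (sqrt_not_mem_QF hm h2 (by rwa [mul_comm, ← hmn])) hL₂
  obtain ⟨σ₃, hσ₃⟩ := exists_conj (hsq 2 _)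
    (sqrt_not_mem_QF hn h2 (by
      rintro ⟨k, hk⟩
      obtain ⟨j, rfl⟩ : 2 ∣ k :=
        (Nat.prime_two.dvd_mul.1 (Dvd.intro_left n hk)).elim id id
      exact hm ⟨j, by subst hmn; linarith⟩)) hL₃
  refine ⟨σ₁, σ₂, σ₃, fun x a b c f hx => ⟨?_, ?_, ?_⟩, fun u =>
    ⟨exists_uval_eq_mul_conj (hsq m _) hL₁ hσ₁ u, exists_uval_eq_mul_conj (hsq 2 _) hL₂ hσ₂ u,
      exists_uval_eq_mul_conj (hsq 2 _) hL₃ hσ₃ u⟩⟩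
  · rw [hσ₁ x _ (rat_add_mul_sqrt_mem_QF 2 a b) _ (rat_add_mul_sqrt_mem_QF 2 c f)
      (by rw [hx, ← hst]; ring), ← hst]
    ring
  · rw [hσ₂ x _ (rat_add_mul_sqrt_mem_QF m a c) _ (rat_add_mul_sqrt_mem_QF m b f)
      (by rw [hx, ← hst]; ring), ← hst]
    ring
  · rw [hσ₃ x _ (rat_add_mul_sqrt_mem_QF n a f) _ (rat_add_mul_sqrt_mem_QF n b (c / 2)) (by
      rw [hx, ← hst]
      push_cast at hs ⊢
      linear_combination -((c : ℝ) / 2 * √m) * hs), ← hst]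
    push_cast at hs ⊢
    linear_combination -((c : ℝ) / 2 * √m) * hs

/-- The square of a unit of the biquadratic field is a product of units of its quadratic
subfields, up to the sign fixed by positivity. -/
theorem sq_uval_eq_of_isFundUnit {m n : ℕ} (hmn : n = 2 * m) (hm : ¬ IsSquare m)
    (hn : ¬ IsSquare n) {e2 em en : ℝ} (he2 : IsFundUnit 2 e2) (hem : IsFundUnit m em)
    (hen : IsFundUnit n en) (u : (integralClosure ℤ (K2 2 m))ˣ) :
    ∃ a b c : ℤ, uval u ^ 2 = e2 ^ a * em ^ b * en ^ c := by
  obtain ⟨σ₁, σ₂, σ₃, hσ, hv⟩ := exists_conjs_K2 hmn hm hn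
  obtain ⟨⟨v₁, h₁⟩, ⟨v₂, h₂⟩, ⟨v₃, h₃⟩⟩ := hv u
  obtain ⟨a, ha⟩ := he2.exists_abs_eq_zpow v₁
  obtain ⟨b, hb⟩ := hem.exists_abs_eq_zpow v₂
  obtain ⟨c, hc⟩ := hen.exists_abs_eq_zpow v₃
  refine ⟨a, b, c, ?_⟩
  obtain ⟨x, y, z, w, hu⟩ := exists_coords_K2 hmn (uval_mem u)
  obtain ⟨e₁, e₂, e₃⟩ := hσ ⟨_, uval_mem u⟩ x y z w hu
  have hs := Real.sq_sqrt ((2 : ℕ).cast_nonneg (α := ℝ))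
  have ht := Real.sq_sqrt (m.cast_nonneg (α := ℝ))
  have hst : √n = √(2 : ℕ) * √m := by rw [sqrt_mul_sqrt_natCast, hmn]
  have hv₁ : uval v₁ = ((x ^ 2 + 2 * y ^ 2 - m * z ^ 2 - 2 * m * w ^ 2 : ℚ) : ℝ) +
      ((2 * x * y - 2 * m * z * w : ℚ) : ℝ) * √(2 : ℕ) := by
    rw [h₁, e₁, hu, hst]
    push_cast at hs ⊢
    linear_combination ((y : ℝ) ^ 2 - w ^ 2 * m) * hs
      - ((z : ℝ) + w * √2) ^ 2 * ht
  have hN := (unit_norm (not_isSquare_of_mod_four (d := 2) (by norm_num)) v₁ hv₁).2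
  have habs : |uval v₁ * (σ₂ ⟨uval u, uval_mem u⟩ * σ₃ ⟨uval u, uval_mem u⟩)| = 1 := by
    have : σ₂ ⟨uval u, uval_mem u⟩ * σ₃ ⟨uval u, uval_mem u⟩ =
        ((x ^ 2 + 2 * y ^ 2 - m * z ^ 2 - 2 * m * w ^ 2 : ℚ) : ℝ) -
        ((2 * x * y - 2 * m * z * w : ℚ) : ℝ) * √(2 : ℕ) := by
      rw [e₂, e₃, hst]
      push_cast at hs ⊢
      linear_combination ((y : ℝ) ^ 2 - w ^ 2 * m) * hs
        - ((z : ℝ) - w * √2) ^ 2 * ht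
    rw [this, hv₁]
    generalize x ^ 2 + 2 * y ^ 2 - m * z ^ 2 - 2 * m * w ^ 2 = A at hN
    generalize 2 * x * y - 2 * m * z * w = B at hN
    have hAB : ((A : ℝ) + B * √(2 : ℕ)) * (A - B * √(2 : ℕ)) =
        ((A ^ 2 - (2 : ℕ) * B ^ 2 : ℚ) : ℝ) := by
      push_cast at hs ⊢
      linear_combination -(B : ℝ) ^ 2 * hs
    rw [hAB]
    rcases hN with hN | hN <;> rw [hN] <;> norm_num
  calc uval u ^ 2 = |uval u ^ 2| *
        |uval v₁ * (σ₂ ⟨uval u, uval_mem u⟩ * σ₃ ⟨uval u, uval_mem u⟩)| := by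
        rw [habs, mul_one, abs_of_nonneg (sq_nonneg _)]
    _ = |uval v₁| * |uval v₂| * |uval v₃| := by
        rw [h₂, h₃, ← abs_mul, ← abs_mul, ← abs_mul]
        congr 1
        ring
    _ = _ := by rw [ha, hb, hc]

theorem sqrt_prime_not_mem_K2 {p q : ℕ} [Fact p.Prime] [Fact q.Prime]
    (hp : p % 8 = 5) (hq : q % 8 = 3) : √(p : ℝ) ∉ K2 2 (p * q) := by
  have h2 : ¬ IsSquare 2 := not_isSquare_of_mod_four (by norm_num)
  have hpp : p.Prime := Fact.out
  have hqq : q.Prime := Fact.out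
  have hp4 : p % 4 = 1 := by omega
  have hq4 : q % 4 = 3 := by omega
  have hpF : √(p : ℝ) ∉ QF 2 := sqrt_not_mem_QF h2 hpp.prime.not_isSquare
    (not_isSquare_of_mod_four (.inl (by omega)))
  have hqF : √(q : ℝ) ∉ QF 2 := sqrt_not_mem_QF h2 hqq.prime.not_isSquare
    (not_isSquare_of_mod_four (.inl (by omega)))
  have hmF : √((p * q : ℕ) : ℝ) ∉ QF 2 := sqrt_not_mem_QF h2
    (not_isSquare_of_mod_four (.inr (by rw [Nat.mul_mod, hp4, hq4])))
    (not_isSquare_of_mod_four (.inl (by rw [Nat.mul_mod, Nat.mul_mod p, hp4, hq4])))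
  intro h
  obtain ⟨α, hα, β, hβ, hw⟩ := exists_eq_of_mem_K2 h
  have hp2 := Real.mul_self_sqrt (p.cast_nonneg (α := ℝ))
  have hm2 := Real.mul_self_sqrt ((p * q : ℕ).cast_nonneg (α := ℝ))
  have key : (p : ℝ) = (α * α + β * β * (p * q : ℕ)) + (2 * α * β) * √((p * q : ℕ) : ℝ) := by
    linear_combination -hp2 + (√(p : ℝ) + α + β * √((p * q : ℕ) : ℝ)) * hw + β ^ 2 * hm2
  by_cases h0 : α * β = 0
  · rcases mul_eq_zero.1 h0 with rfl | rfl
    · refine hqF ?_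
      have hp0 : √(p : ℝ) ≠ 0 := fun h => hpF (h ▸ zero_mem _)
      have hq2 := Real.mul_self_sqrt (q.cast_nonneg (α := ℝ))
      rw [← sqrt_mul_sqrt_natCast, zero_add] at hw
      have h1 : β * √(q : ℝ) = 1 := mul_left_cancel₀ hp0 (by linear_combination -hw)
      rw [show √(q : ℝ) = β * q by
        linear_combination β * hq2 - √(q : ℝ) * h1]
      exact mul_mem hβ (natCast_mem _ q)
    · exact hpF (by rw [hw, zero_mul, add_zero]; exact hα)
  · refine hmF ?_
    have h2 : 2 * α * β ≠ 0 := by rw [mul_assoc]; exact mul_ne_zero two_ne_zero h0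
    rw [show √((p * q : ℕ) : ℝ) = (p - (α * α + β * β * (p * q : ℕ))) / (2 * α * β) by
      rw [eq_div_iff h2]; linear_combination -key]
    exact div_mem (sub_mem (natCast_mem _ p) (add_mem (mul_mem hα hα)
      (mul_mem (mul_mem hβ hβ) (natCast_mem _ _))))
      (mul_mem (mul_mem (natCast_mem _ 2) hα) hβ)

theorem isFundUnit_two_mul_pq_eq {p q : ℕ} [Fact p.Prime] [Fact q.Prime]
    (hp : p % 8 = 5) (hq : q % 8 = 3) (hleg : legendreSym q (p : ℤ) = 1) {t : ℝ}
    (h : IsFundUnit (2 * p * q) t) :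
    ∃ a b : ℤ, t = (q * a ^ 2 + 2 * p * b ^ 2) + 2 * (a * b) * √((2 * p * q : ℕ) : ℝ) ∧
      (q * a ^ 2 - 2 * p * b ^ 2) ^ 2 = 1 := by
  have hpp : p.Prime := Fact.out
  have hqq : q.Prime := Fact.out
  have hpq : p.Coprime q := (Nat.coprime_primes hpp hqq).2 (by omega)
  have h2 : (2 : ℕ).Coprime (p * q) := Nat.coprime_two_left.2
    ((Nat.odd_iff.2 (by omega)).mul (Nat.odd_iff.2 (by omega)))
  obtain ⟨x, y, hxy, hN, hx, hns⟩ := h.exists_pell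
    (.inl (by
      rw [Nat.mul_mod, Nat.mul_mod 2, show p % 4 = 1 by omega, show q % 4 = 3 by omega]))
    (by
      rw [mul_assoc, Nat.squarefree_mul h2, Nat.squarefree_mul hpq]
      exact ⟨Nat.prime_two.squarefree, hpp.squarefree, hqq.squarefree⟩)
    (fun x y => sq_sub_mul_sq_ne_neg_one hq ⟨2 * p, by push_cast; ring⟩)
  obtain ⟨a, b, rfl, rfl⟩ := (pell_two_mul_pq hp hq hleg hx hN).resolve_right hns
  refine ⟨a, b, by rw [hxy]; push_cast; ring, ?_⟩
  push_cast at hN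
  linear_combination hN

theorem isFundUnit_pq_eq {p q : ℕ} [Fact p.Prime] [Fact q.Prime]
    (hp : p % 8 = 5) (hq : q % 8 = 3) (hleg : legendreSym q (p : ℤ) = 1) {t : ℝ}
    (h : IsFundUnit (p * q) t) :
    ∃ a b : ℤ, t = (p * a ^ 2 + q * b ^ 2) + 2 * (a * b) * √((p * q : ℕ) : ℝ) := by
  have hpp : p.Prime := Fact.out
  have hqq : q.Prime := Fact.out
  have hpq : p.Coprime q := (Nat.coprime_primes hpp hqq).2 (by omega)
  obtain ⟨x, y, hxy, hN, hx, hns⟩ := h.exists_pell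
    (.inr (by rw [Nat.mul_mod, show p % 4 = 1 by omega, show q % 4 = 3 by omega]))
    ((Nat.squarefree_mul hpq).2 ⟨hpp.squarefree, hqq.squarefree⟩)
    (fun x y => sq_sub_mul_sq_ne_neg_one hq ⟨p, by push_cast; ring⟩)
  obtain ⟨a, b, rfl, rfl⟩ := (pell_pq hp hq hleg hx hN).resolve_right hns
  exact ⟨a, b, by rw [hxy]; push_cast; ring⟩

theorem fsu_Qsqrt2_sqrtpq_legendre_one
    (p q : ℕ) [Fact (Nat.Prime p)] [Fact (Nat.Prime q)]
    (hp : p % 8 = 5) (hq : q % 8 = 3) (hleg : legendreSym q (p : ℤ) = 1)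
    (e2 epq e2pq : ℝ)
    (he2 : IsFundUnit 2 e2) (hepq : IsFundUnit (p * q) epq)
    (he2pq : IsFundUnit (2 * p * q) e2pq) :
    (∃ E2 : (integralClosure ℤ (K2 2 (p * q)))ˣ, uval E2 = e2) ∧
    (∃ Epq : (integralClosure ℤ (K2 2 (p * q)))ˣ, uval Epq = epq) ∧
    (∃ U : (integralClosure ℤ (K2 2 (p * q)))ˣ, uval U ^ 2 = epq * e2pq) ∧
    ∀ E2 Epq U : (integralClosure ℤ (K2 2 (p * q)))ˣ,
      uval E2 = e2 → uval Epq = epq → uval U ^ 2 = epq * e2pq →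
      Subgroup.closure {(-1 : (integralClosure ℤ (K2 2 (p * q)))ˣ), E2, Epq, U} = ⊤ := by
  have hp4 : p % 4 = 1 := by omega
  have hq4 : q % 4 = 3 := by omega
  have hm : ¬ IsSquare (p * q) :=
    not_isSquare_of_mod_four (.inr (by rw [Nat.mul_mod, hp4, hq4]))
  have hn : ¬ IsSquare (2 * p * q) :=
    not_isSquare_of_mod_four (.inl (by rw [Nat.mul_mod, Nat.mul_mod 2, hp4, hq4]))
  have hmn : 2 * p * q = 2 * (p * q) := mul_assoc 2 p q
  have hst : √((2 * p * q : ℕ) : ℝ) = √(2 : ℕ) * √((p * q : ℕ) : ℝ) := by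
    rw [sqrt_mul_sqrt_natCast, hmn]
  have hs := Real.sq_sqrt ((2 : ℕ).cast_nonneg (α := ℝ))
  have ht := Real.sq_sqrt ((p * q : ℕ).cast_nonneg (α := ℝ))
  have hsK : √((2 : ℕ) : ℝ) ∈ K2 2 (p * q) := IntermediateField.subset_adjoin ℚ _ (.inl rfl)
  have htK : √((p * q : ℕ) : ℝ) ∈ K2 2 (p * q) := IntermediateField.subset_adjoin ℚ _ (.inr rfl)
  have hstK : √((2 * p * q : ℕ) : ℝ) ∈ K2 2 (p * q) := by rw [hst]; exact mul_mem hsK htK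
  obtain ⟨F2, hF2⟩ : ∃ E2 : (integralClosure ℤ (K2 2 (p * q)))ˣ, uval E2 = e2 :=
    he2.choose_spec.1 ▸ exists_uval_eq_of_le (QF_le hsK) he2.choose
  obtain ⟨Fpq, hFpq⟩ : ∃ E : (integralClosure ℤ (K2 2 (p * q)))ˣ, uval E = epq :=
    hepq.choose_spec.1 ▸ exists_uval_eq_of_le (QF_le htK) hepq.choose
  obtain ⟨F2pq, hF2pq⟩ : ∃ E : (integralClosure ℤ (K2 2 (p * q)))ˣ, uval E = e2pq :=
    he2pq.choose_spec.1 ▸ exists_uval_eq_of_le (QF_le hstK) he2pq.choose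
  have e2_pos := zero_lt_one.trans he2.one_lt
  have epq_pos := zero_lt_one.trans hepq.one_lt
  have e2pq_pos := zero_lt_one.trans he2pq.one_lt
  obtain ⟨a, b, hab⟩ := isFundUnit_pq_eq hp hq hleg hepq
  obtain ⟨c, d, hcd, hcd1⟩ := isFundUnit_two_mul_pq_eq hp hq hleg he2pq
  obtain ⟨x, y, hxy, hxyN⟩ := he2.two_norm
  refine ⟨⟨F2, hF2⟩, ⟨Fpq, hFpq⟩, ?_, ?_⟩
  · set s : ℝ := √((2 : ℕ) : ℝ)
    set t : ℝ := √((p * q : ℕ) : ℝ)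
    set w : ℝ := (((b * c * q : ℤ) : ℝ) + (a * d * p : ℤ) * s) +
      (((a * c : ℤ) : ℝ) + (b * d : ℤ) * s) * t with hw_def
    have hw : w ^ 2 = epq * e2pq := by
      rw [hab, hcd, hst]
      push_cast at hs ht hw_def ⊢
      rw [hw_def]
      linear_combination (((a : ℝ) * d * p) ^ 2 + (b * d) ^ 2 * t ^ 2
          + 2 * (a * d * p) * (b * d) * t) * hs
        + (((a : ℝ) * c) ^ 2 + 2 * (b * d) ^ 2 - 2 * (a * b * c * d) * s) * ht
    have hwi : IsIntegral ℤ w := (isIntegral_int_add_mul_sqrt 2 _ _).add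
      ((isIntegral_int_add_mul_sqrt 2 _ _).mul (isIntegral_sqrt _))
    have hwK : w ∈ K2 2 (p * q) :=
      add_mem (add_mem (intCast_mem _ _) (mul_mem (intCast_mem _ _) hsK))
        (mul_mem (add_mem (intCast_mem _ _) (mul_mem (intCast_mem _ _) hsK)) htK)
    obtain ⟨U, hU⟩ := exists_uval_eq hwK hwi
      ((hwi.mul (isIntegral_uval Fpq⁻¹)).mul (isIntegral_uval F2pq⁻¹)) (by
        rw [uval_inv, uval_inv, hFpq, hF2pq]
        field_simp
        exact hw)
    exact ⟨U, by rw [hU, hw]⟩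
  · intro E2 Epq U hE2 hEpq hU
    rw [eq_top_iff]
    intro u _
    obtain ⟨i, j, k, hijk⟩ := sq_uval_eq_of_isFundUnit hmn hm hn he2 hepq he2pq u
    obtain ⟨_, σ, _, hσ, -⟩ := exists_conjs_K2 hmn hm hn
    have hi : Even i := by
      let T : (integralClosure ℤ (K2 2 (p * q)))ˣ → K2 2 (p * q) := fun v => ⟨uval v, uval_mem v⟩
      have hσ2 : σ (T F2) = -e2⁻¹ := by
        have h1 := (hσ (T F2) x y 0 0 (by simpa using hF2.trans hxy)).2.1
        have h2 : (x : ℝ) ^ 2 - 2 * y ^ 2 = -1 := by exact_mod_cast hxyN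
        rw [h1, ← neg_eq_iff_eq_neg]
        refine eq_inv_of_mul_eq_one_left ?_
        rw [hxy]
        push_cast at hs ⊢
        linear_combination -h2 + (y : ℝ) ^ 2 * hs
      have hσpq : σ (T Fpq) = epq := by
        rw [(hσ (T Fpq) (p * a ^ 2 + q * b ^ 2) 0 (2 * (a * b)) 0 (by
          push_cast; simpa using hFpq.trans hab)).2.1, hab]
        push_cast; ring
      have hσ2pq : σ (T F2pq) = e2pq⁻¹ := by
        rw [(hσ (T F2pq) (q * c ^ 2 + 2 * p * d ^ 2) 0 0 (2 * (c * d)) (by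
          push_cast; simpa using hF2pq.trans hcd)).2.1]
        refine eq_inv_of_mul_eq_one_left ?_
        have h1 : ((q : ℝ) * c ^ 2 - 2 * p * d ^ 2) ^ 2 = 1 := by exact_mod_cast hcd1
        rw [hcd, hst]
        push_cast at hs ht ⊢
        linear_combination h1 - 4 * (c * d : ℝ) ^ 2 * (√(p * q : ℝ) ^ 2 * hs + 2 * ht)
      have hK : T u ^ 2 = T F2 ^ i * T Fpq ^ j * T F2pq ^ k := by
        apply (algebraMap (K2 2 (p * q)) ℝ).injective
        simp only [map_pow, map_mul, map_zpow₀]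
        change uval u ^ 2 = uval F2 ^ i * uval Fpq ^ j * uval F2pq ^ k
        rw [hF2, hFpq, hF2pq, hijk]
      have hσK := congrArg σ hK
      simp only [map_pow, map_mul, map_zpow₀, hσ2, hσpq, hσ2pq] at hσK
      by_contra hodd
      rw [(Int.not_even_iff_odd.1 hodd).neg_zpow] at hσK
      have : 0 < e2⁻¹ ^ i * epq ^ j * e2pq⁻¹ ^ k := by positivity
      nlinarith [sq_nonneg (σ (T u))]
    obtain ⟨i, rfl⟩ := hi
    have hu2 : ∀ l : ℤ, uval (u * (E2 ^ i * Epq ^ l * U ^ k)⁻¹) ^ 2 = epq ^ (j - k - 2 * l) := by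
      intro l
      have hUk : (uval U ^ k) ^ 2 = epq ^ k * e2pq ^ k := by
        rw [← mul_zpow, ← hU, ← zpow_natCast, ← zpow_natCast, ← zpow_mul, ← zpow_mul, mul_comm k]
      rw [uval_mul, uval_inv, uval_mul, uval_mul, uval_zpow, uval_zpow, uval_zpow, hE2, hEpq,
        mul_pow, inv_pow, mul_pow, mul_pow, hUk, hijk, zpow_add₀ e2_pos.ne', zpow_sub₀ epq_pos.ne',
        zpow_sub₀ epq_pos.ne', two_mul, zpow_add₀ epq_pos.ne']
      field_simp
    have hmem : ∀ l : ℤ, E2 ^ i * Epq ^ l * U ^ k ∈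
        Subgroup.closure {(-1 : (integralClosure ℤ (K2 2 (p * q)))ˣ), E2, Epq, U} := fun l =>
      mul_mem (mul_mem (zpow_mem (Subgroup.subset_closure (by simp)) _)
        (zpow_mem (Subgroup.subset_closure (by simp)) _))
        (zpow_mem (Subgroup.subset_closure (by simp)) _)
    obtain ⟨l, hl | hl⟩ := Int.even_or_odd' (j - k)
    · have h1 := hu2 l
      rw [hl, sub_self, zpow_zero] at h1
      rcases mul_self_eq_one_iff.1 ((sq _).symm.trans h1) with h1 | h1
      · rw [eq_of_mul_inv_eq_one (uval_injective (h1.trans uval_one.symm))]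
        exact hmem l
      · have h2 : u * (E2 ^ i * Epq ^ l * U ^ k)⁻¹ = -1 :=
          uval_injective (h1.trans (by rw [uval_neg, uval_one]))
        rw [mul_inv_eq_iff_eq_mul] at h2
        rw [h2]
        exact mul_mem (Subgroup.subset_closure (by simp)) (hmem l)
    · exfalso
      have h1 := hu2 l
      rw [hl, add_sub_cancel_left, zpow_one] at h1
      set v := u * (E2 ^ i * Epq ^ l * U ^ k)⁻¹
      have hv0 := uval_ne_zero v
      set z : ℝ := (p * a + b * √((p * q : ℕ) : ℝ)) / uval v with hz
      have hzK : z ∈ K2 2 (p * q) := div_mem (add_mem (mul_mem (natCast_mem _ p) (intCast_mem _ a))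
        (mul_mem (intCast_mem _ b) htK)) (uval_mem v)
      have hz2 : z ^ 2 = p := by
        rw [hz, div_pow, h1, div_eq_iff epq_pos.ne', hab]
        push_cast at ht ⊢
        linear_combination (b : ℝ) ^ 2 * ht
      refine sqrt_prime_not_mem_K2 (p := p) (q := q) hp hq ?_
      rw [← hz2, Real.sqrt_sq_eq_abs]
      rcases abs_choice z with h | h <;> rw [h]
      exacts [hzK, neg_mem hzK]
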